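/- arXiv:2412.00027 — 5 statements merged into one kernel-verified Lean document; each statement's English description precedes it below -/
import Mathlib

section
/- Let (D,μ) be a σ-finite measure space, let q > 1/2, let C₀, C₁, C₂, C, η be positive reals, E ≥ 0, and let L be a positive integer. Let (φ_ℓ)_{ℓ≥1}, (u_ℓ)_{ℓ=1}^L and (v_ℓ)_{ℓ=1}^L be orthonormal families in L²(μ;ℝ). Let (λ_ℓ)_{ℓ≥1}, (λ^h_ℓ)_{ℓ=1}^L, (b_ℓ)_{ℓ=1}^L, (δ_ℓ)_{ℓ=1}^L be reals satisfying: 0 < λ_ℓ ≤ C₀ ℓ^{−q} for all ℓ ≥ 1; 0 ≤ λ^h_ℓ ≤ λ_ℓ, |λ_ℓ − λ^h_ℓ| ≤ C₁ λ_ℓ^{−1} η², and ‖φ_ℓ − u_ℓ‖_{L²(μ)} ≤ C₂ λ_ℓ^{−1} η for 1 ≤ ℓ ≤ L; C₂ η ≤ λ_ℓ for 1 ≤ ℓ ≤ L; |λ^h_ℓ − b_ℓ| ≤ E, δ_ℓ > 0, δ_ℓ ≥ 4E, and ‖u_ℓ − v_ℓ‖_{L²(μ)} ≤ 4C δ_ℓ^{−1}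 E for 1 ≤ ℓ ≤ L. Then R := Σ_{ℓ≥1} λ_ℓ (φ_ℓ ⊗ φ_ℓ) converges in L²(μ⊗μ), and with G(L) := (Σ_{ℓ=1}^L (δ_ℓ^{−1} λ_ℓ)²)^{1/2} one has ‖R − Σ_{ℓ=1}^L b_ℓ (v_ℓ ⊗ v_ℓ)‖_{L²(μ⊗μ)} ≤ C₀ (2q−1)^{−1/2} L^{−(q−1/2)} + (C₁/C₂ + 2C₂) L^{1/2} η + E·((1 + √2·C) L^{1/2} + 4√2·C·G(L)). -/
open MeasureTheory

theorem memLp_two_prod_mul {D D' : Type*} [MeasurableSpace D] [MeasurableSpace D']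
    {μ : Measure D} {ν : Measure D'} [SFinite μ] [SFinite ν] (f : Lp ℝ 2 μ) (g : Lp ℝ 2 ν) :
    MemLp (fun z : D × D' => f z.1 * g z.2) 2 (μ.prod ν) := by
  have hf := (Lp.memLp f).aestronglyMeasurable
  have hg := (Lp.memLp g).aestronglyMeasurable
  refine (memLp_two_iff_integrable_sq (hf.comp_fst.mul hg.comp_snd)).2 ?_
  simpa only [Pi.mul_apply, mul_pow] using (Lp.memLp f).integrable_sq.mul_prod (Lp.memLp g).integrable_sq

/-- The inner product of two elementary tensors in `L²(μ ⊗ ν)` factorizes. -/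
theorem inner_eq_mul_inner_of_ae_eq_mul {D D' : Type*} [MeasurableSpace D] [MeasurableSpace D']
    {μ : Measure D} {ν : Measure D'} [SFinite μ] [SFinite ν]
    {f f' : Lp ℝ 2 μ} {g g' : Lp ℝ 2 ν} {S S' : Lp ℝ 2 (μ.prod ν)}
    (hS : ⇑S =ᵐ[μ.prod ν] fun z => f z.1 * g z.2)
    (hS' : ⇑S' =ᵐ[μ.prod ν] fun z => f' z.1 * g' z.2) :
    inner ℝ S S' = inner ℝ f f' * inner ℝ g g' := by
  simp only [L2.inner_def]
  rw [← integral_prod_mul]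
  refine integral_congr_ae ?_
  filter_upwards [hS, hS'] with z hz hz'
  simp only [hz, hz', RCLike.inner_apply, conj_trivial]
  ring

theorem orthonormal_of_ae_eq_mul {D ι : Type*} [MeasurableSpace D]
    {μ : Measure D} [SFinite μ] {f : ι → Lp ℝ 2 μ} (hf : Orthonormal ℝ f)
    {S : ι → Lp ℝ 2 (μ.prod μ)}
    (hS : ∀ i, ⇑(S i) =ᵐ[μ.prod μ] fun z => f i z.1 * f i z.2) :
    Orthonormal ℝ S := by
  classical
  rw [orthonormal_iff_ite] at hf ⊢
  intro i j
  rw [inner_eq_mul_inner_of_ae_eq_mul (hS i) (hS j), hf]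
  split_ifs <;> simp

theorem Orthonormal.norm_sq_sum_smul {H ι : Type*} [NormedAddCommGroup H]
    [InnerProductSpace ℝ H] {x : ι → H} (hx : Orthonormal ℝ x) (s : Finset ι) (c : ι → ℝ) :
    ‖∑ i ∈ s, c i • x i‖ ^ 2 = ∑ i ∈ s, c i ^ 2 := by
  rw [← real_inner_self_eq_norm_sq, hx.inner_sum]
  simp [sq]

theorem Orthonormal.norm_sum_smul_le {H ι : Type*} [NormedAddCommGroup H]
    [InnerProductSpace ℝ H] [Fintype ι] {x : ι → H} (hx : Orthonormal ℝ x) {c : ι → ℝ} {M : ℝ}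
    (hM : 0 ≤ M) (hc : ∀ i, |c i| ≤ M) :
    ‖∑ i, c i • x i‖ ≤ √(Fintype.card ι) * M := by
  refine le_of_sq_le_sq ?_ (by positivity)
  rw [hx.norm_sq_sum_smul, mul_pow, Real.sq_sqrt (by positivity)]
  calc ∑ i, c i ^ 2 ≤ ∑ _i : ι, M ^ 2 :=
        Finset.sum_le_sum fun i _ => sq_le_sq' (neg_le_of_abs_le (hc i)) (le_of_abs_le (hc i))
    _ = Fintype.card ι * M ^ 2 := by simp

/-- If `X i` and `Y i` play the role of the tensor squares of the unit vectors `x i` and `y i`,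
then nonnegative combinations of the differences `X i - Y i` are controlled by the
differences `x i - y i`. -/
theorem norm_sum_smul_sub_le_sqrt {H K ι : Type*} [NormedAddCommGroup H] [InnerProductSpace ℝ H]
    [NormedAddCommGroup K] [InnerProductSpace ℝ K] [Fintype ι] {x y : ι → H} {X Y : ι → K}
    (hx : ∀ i, ‖x i‖ = 1) (hy : ∀ i, ‖y i‖ = 1)
    (hX : Orthonormal ℝ X) (hY : Orthonormal ℝ Y)
    (hXY : ∀ i j, inner ℝ (X i) (Y j) = inner ℝ (x i) (y j) ^ 2)
    {c : ι → ℝ} (hc : ∀ i, 0 ≤ c i) :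
    ‖∑ i, c i • (X i - Y i)‖ ≤ √2 * √(∑ i, (c i * ‖x i - y i‖) ^ 2) := by
  rw [← Real.sqrt_mul zero_le_two]
  refine Real.le_sqrt_of_sq_le ?_
  have hcross : ∑ i, c i ^ 2 * inner ℝ (x i) (y i) ^ 2 ≤
      inner ℝ (∑ i, c i • X i) (∑ j, c j • Y j) := by
    rw [sum_inner]
    refine Finset.sum_le_sum fun i _ => ?_
    rw [inner_sum]
    have hnn : ∀ j ∈ Finset.univ, 0 ≤ inner ℝ (c i • X i) (c j • Y j) := fun j _ => by
      rw [real_inner_smul_left, real_inner_smul_right, hXY]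
      have := hc i
      have := hc j
      positivity
    refine le_trans (le_of_eq ?_) (Finset.single_le_sum hnn (Finset.mem_univ i))
    rw [real_inner_smul_left, real_inner_smul_right, hXY]
    ring
  simp only [smul_sub, Finset.sum_sub_distrib]
  rw [norm_sub_sq_real, hX.norm_sq_sum_smul, hY.norm_sq_sum_smul]
  have hterm : ∑ i, (c i ^ 2 - c i ^ 2 * inner ℝ (x i) (y i) ^ 2) ≤
      ∑ i, (c i * ‖x i - y i‖) ^ 2 := by
    refine Finset.sum_le_sum fun i _ => ?_
    rw [mul_pow, norm_sub_sq_real, hx, hy]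
    nlinarith [mul_nonneg (sq_nonneg (c i)) (sq_nonneg (1 - inner ℝ (x i) (y i)))]
  rw [Finset.sum_sub_distrib] at hterm
  linarith

theorem sum_range_rpow_neg_le {p : ℝ} (hp : 1 < p) {L : ℕ} (hL : 0 < L) (N : ℕ) :
    ∑ i ∈ Finset.range N, ((L : ℝ) + (i + 1 : ℕ)) ^ (-p) ≤ (L : ℝ) ^ (1 - p) / (p - 1) := by
  have hL' : (0 : ℝ) < L := by exact_mod_cast hL
  have hanti : AntitoneOn (fun t : ℝ => t ^ (-p)) (Set.Icc (L : ℝ) (L + N)) :=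
    fun s hs t _ hst => Real.rpow_le_rpow_of_nonpos (hL'.trans_le hs.1) hst (by linarith)
  refine hanti.sum_le_integral.trans ?_
  rw [integral_rpow (Or.inr ⟨by linarith, ?_⟩)]
  · rw [show -p + 1 = -(p - 1) by ring, div_neg, ← neg_div, show 1 - p = -(p - 1) by ring]
    refine div_le_div_of_nonneg_right ?_ (by linarith)
    linarith [Real.rpow_nonneg (show (0 : ℝ) ≤ L + N by positivity) (-(p - 1))]
  · rw [Set.uIcc_of_le (by simp)]
    exact fun h => absurd h.1 (not_le.2 hL')

theorem Orthonormal.summable_smul_of_summable_sq {H : Type*} [NormedAddCommGroup H]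
    [InnerProductSpace ℝ H] [CompleteSpace H] {x : ℕ → H} (hx : Orthonormal ℝ x) {c : ℕ → ℝ}
    (hc : Summable fun n => c n ^ 2) : Summable fun n => c n • x n := by
  have := (hx.orthogonalFamily.summable_iff_norm_sq_summable c).2 (by simpa using hc)
  simpa using this

theorem norm_tsum_le_of_norm_sum_range_le {H : Type*} [NormedAddCommGroup H] {f : ℕ → H}
    (hf : Summable f) {B : ℝ} (hB : ∀ N, ‖∑ i ∈ Finset.range N, f i‖ ≤ B) :
    ‖∑' i, f i‖ ≤ B :=
  le_of_tendsto hf.hasSum.tendsto_sum_nat.norm (Filter.Eventually.of_forall hB)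

/-- **Full covariance reconstruction error bound** (abstract core of the paper's Theorem 4.1).
All families are indexed by `ℕ`, with index `n` corresponding to `ℓ = n + 1` in the paper.
`λ_ℓ` are the eigenvalues of the covariance operator (decay exponent `q = 2s/d + 1`),
`η = h^s` is the finite-element parameter, `E` the matrix sampling error, `δ_ℓ` the spectral
gaps; `T ℓ = φ_ℓ ⊗ φ_ℓ` and `Tv ℓ = v_ℓ ⊗ v_ℓ` are elements of `L²(μ ⊗ μ)`.
Then `R = ∑_{ℓ ≥ 1} λ_ℓ (φ_ℓ ⊗ φ_ℓ)` converges in `L²(μ ⊗ μ)` and, with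
`G(L) = (∑_{ℓ=1}^L (δ_ℓ⁻¹ λ_ℓ)²)^{1/2}`,
`‖R − ∑_{ℓ=1}^L b_ℓ (v_ℓ ⊗ v_ℓ)‖ ≤ C₀ (2q−1)^{-1/2} L^{-(q-1/2)} + (C₁/C₂ + 2C₂) L^{1/2} η
 + E ((1 + √2 C) L^{1/2} + 4√2 C G(L))`. -/
theorem covariance_reconstruction_error
    {D : Type*} [MeasurableSpace D] (μ : Measure D) [SigmaFinite μ]
    (q C₀ C₁ C₂ C η : ℝ) (hq : 1 / 2 < q)
    (hC₀ : 0 < C₀) (hC₁ : 0 < C₁) (hC₂ : 0 < C₂) (hC : 0 < C) (hη : 0 < η)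
    (E : ℝ) (hE : 0 ≤ E)
    (L : ℕ) (hL : 0 < L)
    (φ u v : ℕ → Lp ℝ 2 μ)
    (hφ : Orthonormal ℝ φ)
    (hu : Orthonormal ℝ (fun i : Fin L => u i))
    (hv : Orthonormal ℝ (fun i : Fin L => v i))
    (lam lamh b δ : ℕ → ℝ)
    (hlam_pos : ∀ ℓ, 0 < lam ℓ)
    (hlam : ∀ ℓ : ℕ, lam ℓ ≤ C₀ * ((ℓ : ℝ) + 1) ^ (-q))
    (hlamh_nonneg : ∀ ℓ < L, 0 ≤ lamh ℓ)
    (hlamh_le : ∀ ℓ < L, lamh ℓ ≤ lam ℓ)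
    (heig_err : ∀ ℓ < L, |lam ℓ - lamh ℓ| ≤ C₁ * (lam ℓ)⁻¹ * η ^ 2)
    (hfun_err : ∀ ℓ < L, ‖φ ℓ - u ℓ‖ ≤ C₂ * (lam ℓ)⁻¹ * η)
    (hres : ∀ ℓ < L, C₂ * η ≤ lam ℓ)
    (hb : ∀ ℓ < L, |lamh ℓ - b ℓ| ≤ E)
    (hδ_pos : ∀ ℓ < L, 0 < δ ℓ)
    (hδE : ∀ ℓ < L, 4 * E ≤ δ ℓ)
    (huv : ∀ ℓ < L, ‖u ℓ - v ℓ‖ ≤ 4 * C * (δ ℓ)⁻¹ * E)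
    (T Tv : ℕ → Lp ℝ 2 (μ.prod μ))
    (hT : ∀ ℓ, ⇑(T ℓ) =ᵐ[μ.prod μ] fun z : D × D => φ ℓ z.1 * φ ℓ z.2)
    (hTv : ∀ ℓ < L, ⇑(Tv ℓ) =ᵐ[μ.prod μ] fun z : D × D => v ℓ z.1 * v ℓ z.2) :
    Summable (fun ℓ : ℕ => lam ℓ • T ℓ) ∧
    ‖(∑' ℓ : ℕ, lam ℓ • T ℓ) - ∑ ℓ ∈ Finset.range L, b ℓ • Tv ℓ‖ ≤
      C₀ * (2 * q - 1) ^ (-(1 / 2 : ℝ)) * (L : ℝ) ^ (-(q - 1 / 2)) +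
      (C₁ / C₂ + 2 * C₂) * (L : ℝ) ^ ((1 : ℝ) / 2) * η +
      E * ((1 + Real.sqrt 2 * C) * (L : ℝ) ^ ((1 : ℝ) / 2) +
        4 * Real.sqrt 2 * C *
          Real.sqrt (∑ ℓ ∈ Finset.range L, ((δ ℓ)⁻¹ * lam ℓ) ^ 2)) := by
  have hL' : (0 : ℝ) < L := by exact_mod_cast hL
  have hqpos : 0 < 2 * q - 1 := by linarith
  have hTon : Orthonormal ℝ T := orthonormal_of_ae_eq_mul hφ hT
  have htail_sq : ∀ N : ℕ, ∑ i ∈ Finset.range N, lam (i + L) ^ 2 ≤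
      (C₀ * (2 * q - 1) ^ (-(1 / 2 : ℝ)) * (L : ℝ) ^ (-(q - 1 / 2))) ^ 2 := by
    intro N
    calc ∑ i ∈ Finset.range N, lam (i + L) ^ 2
        ≤ ∑ i ∈ Finset.range N, C₀ ^ 2 * ((L : ℝ) + (i + 1 : ℕ)) ^ (-(2 * q)) := by
          refine Finset.sum_le_sum fun i _ => ?_
          refine (pow_le_pow_left₀ (hlam_pos _).le (hlam _) 2).trans_eq ?_
          rw [mul_pow, ← Real.rpow_mul_natCast (by positivity)]
          push_cast
          congr 2 <;> ring
      _ ≤ C₀ ^ 2 * ((L : ℝ) ^ (1 - 2 * q) / (2 * q - 1)) := by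
          rw [← Finset.mul_sum]
          gcongr
          exact sum_range_rpow_neg_le (by linarith) hL N
      _ = _ := by
          rw [mul_pow, mul_pow, ← Real.rpow_mul_natCast hqpos.le,
            ← Real.rpow_mul_natCast hL'.le]
          push_cast
          rw [show -(1 / 2 : ℝ) * 2 = -1 by norm_num, Real.rpow_neg_one,
            show -(q - 1 / 2) * 2 = 1 - 2 * q by ring]
          ring
  have hlam_sq : Summable fun n => lam n ^ 2 :=
    (summable_nat_add_iff L).1 (summable_of_sum_range_le (fun _ => sq_nonneg _) htail_sq)
  have hsum : Summable fun ℓ : ℕ => lam ℓ • T ℓ := hTon.summable_smul_of_summable_sq hlam_sq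
  refine ⟨hsum, ?_⟩
  have htail : ‖∑' i, lam (i + L) • T (i + L)‖ ≤
      C₀ * (2 * q - 1) ^ (-(1 / 2 : ℝ)) * (L : ℝ) ^ (-(q - 1 / 2)) := by
    refine norm_tsum_le_of_norm_sum_range_le ((summable_nat_add_iff L).2 hsum) fun N => ?_
    refine le_of_sq_le_sq ?_ (by positivity)
    exact ((hTon.comp (fun i => i + L) (add_left_injective L)).norm_sq_sum_smul
      (Finset.range N) fun i => lam (i + L)).trans_le (htail_sq N)
  let Tu : Fin L → Lp ℝ 2 (μ.prod μ) := fun i => (memLp_two_prod_mul (u i) (u i)).toLp _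
  have hTu : ∀ i : Fin L, ⇑(Tu i) =ᵐ[μ.prod μ] fun z : D × D => u i z.1 * u i z.2 :=
    fun i => MemLp.coeFn_toLp _
  have hTuon : Orthonormal ℝ Tu := orthonormal_of_ae_eq_mul hu hTu
  have hTvon : Orthonormal ℝ (fun i : Fin L => Tv i) :=
    orthonormal_of_ae_eq_mul hv fun i => hTv i i.2
  have hTφon : Orthonormal ℝ (fun i : Fin L => T i) := hTon.comp _ Fin.val_injective
  have heig : ‖∑ i : Fin L, (lam i - lamh i) • T i‖ ≤ √L * (C₁ / C₂ * η) := by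
    have h := hTφon.norm_sum_smul_le (c := fun i => lam i - lamh i) (M := C₁ / C₂ * η)
      (by positivity) fun i => (heig_err i i.2).trans ?_
    · simpa using h
    · have hinv : (lam i)⁻¹ ≤ (C₂ * η)⁻¹ := inv_anti₀ (by positivity) (hres i i.2)
      calc C₁ * (lam i)⁻¹ * η ^ 2 ≤ C₁ * (C₂ * η)⁻¹ * η ^ 2 := by gcongr
        _ = C₁ / C₂ * η := by field_simp
  have hsample : ‖∑ i : Fin L, (lamh i - b i) • Tv i‖ ≤ √L * E := by
    simpa using hTvon.norm_sum_smul_le (c := fun i => lamh i - b i) hE fun i => hb i i.2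
  have hfun : ‖∑ i : Fin L, lamh i • (T i - Tu i)‖ ≤ √L * (2 * C₂ * η) := by
    refine (norm_sum_smul_sub_le_sqrt (x := fun i : Fin L => φ i) (y := fun i : Fin L => u i)
      (fun i => hφ.1 i) hu.1 hTφon hTuon
      (fun i j => (inner_eq_mul_inner_of_ae_eq_mul (hT i) (hTu j)).trans (sq _).symm)
      fun i => hlamh_nonneg i i.2).trans ?_
    have hsq : ∑ i : Fin L, (lamh i * ‖φ i - u i‖) ^ 2 ≤ L * (C₂ * η) ^ 2 := by
      calc _ ≤ ∑ _i : Fin L, (C₂ * η) ^ 2 := by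
            refine Finset.sum_le_sum fun i _ => ?_
            have hpos := hlam_pos i
            have h0 := hlamh_nonneg i i.2
            refine pow_le_pow_left₀ (by positivity) ?_ 2
            calc lamh i * ‖φ i - u i‖ ≤ lam i * (C₂ * (lam i)⁻¹ * η) :=
                  mul_le_mul (hlamh_le i i.2) (hfun_err i i.2) (norm_nonneg _) hpos.le
              _ = C₂ * η := by field_simp
        _ = L * (C₂ * η) ^ 2 := by simp
    calc _ ≤ √2 * √(L * (C₂ * η) ^ 2) := by gcongr
      _ = √2 * (√L * (C₂ * η)) := by
          rw [Real.sqrt_mul hL'.le, Real.sqrt_sq (by positivity)]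
      _ ≤ 2 * (√L * (C₂ * η)) := by
          gcongr
          exact Real.sqrt_le_iff.2 ⟨by norm_num, by norm_num⟩
      _ = √L * (2 * C₂ * η) := by ring
  have hgap : ‖∑ i : Fin L, lamh i • (Tu i - Tv i)‖ ≤
      E * (4 * √2 * C * √(∑ ℓ ∈ Finset.range L, ((δ ℓ)⁻¹ * lam ℓ) ^ 2)) := by
    refine (norm_sum_smul_sub_le_sqrt (x := fun i : Fin L => u i) (y := fun i : Fin L => v i)
      hu.1 hv.1 hTuon hTvon
      (fun i j => (inner_eq_mul_inner_of_ae_eq_mul (hTu i) (hTv j j.2)).trans (sq _).symm)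
      fun i => hlamh_nonneg i i.2).trans ?_
    have hsq : ∑ i : Fin L, (lamh i * ‖u i - v i‖) ^ 2 ≤
        (4 * C * E) ^ 2 * ∑ ℓ ∈ Finset.range L, ((δ ℓ)⁻¹ * lam ℓ) ^ 2 := by
      rw [Finset.sum_range, Finset.mul_sum]
      refine Finset.sum_le_sum fun i _ => ?_
      have h0 := hlamh_nonneg i i.2
      rw [← mul_pow]
      refine pow_le_pow_left₀ (by positivity) ?_ 2
      calc lamh i * ‖u i - v i‖ ≤ lam i * (4 * C * (δ i)⁻¹ * E) :=
            mul_le_mul (hlamh_le i i.2) (huv i i.2) (norm_nonneg _) (hlam_pos i).le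
        _ = 4 * C * E * ((δ i)⁻¹ * lam i) := by ring
    refine (mul_le_mul_of_nonneg_left (Real.sqrt_le_sqrt hsq) (Real.sqrt_nonneg 2)).trans_eq ?_
    rw [Real.sqrt_mul (by positivity), Real.sqrt_sq (by positivity)]
    ring
  have hdecomp : (∑' ℓ : ℕ, lam ℓ • T ℓ) - ∑ ℓ ∈ Finset.range L, b ℓ • Tv ℓ =
      (∑' i, lam (i + L) • T (i + L)) + ((∑ i : Fin L, (lam i - lamh i) • T i) +
        ((∑ i : Fin L, lamh i • (T i - Tu i)) + ((∑ i : Fin L, lamh i • (Tu i - Tv i)) +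
          ∑ i : Fin L, (lamh i - b i) • Tv i))) := by
    rw [← hsum.sum_add_tsum_nat_add L, Finset.sum_range, Finset.sum_range]
    simp only [smul_sub, sub_smul, Finset.sum_sub_distrib]
    abel
  rw [hdecomp, ← Real.sqrt_eq_rpow]
  refine (norm_add_le_of_le htail (norm_add_le_of_le heig (norm_add_le_of_le hfun
    (norm_add_le_of_le hgap hsample)))).trans ?_
  have hextra : 0 ≤ E * (√2 * C * √L) := by positivity
  linarith
end

section
/- Let (Ω,P) be a probability space, p, M, L, τ positive integers, and ρ₁ > 0. Let S : Ω → ℝ^{p×p} be a Bochner-integrable random symmetric matrix with expectation E[S], and let Σ be a symmetric p×p real matrix. Let W = L̃ L̃ᵀ be a symmetric positive definite p×p matrix with factor L̃, and let λ_W denote the largest eigenvalue of W. Let δ₁, …, δ_L > 0 with Δ := min_{1≤ℓ≤L} δ_ℓ, let λ₂, …, λ_{L+1} > 0, and let C₁, h, s > 0. Assume: (i) δ_ℓ ≥ 8 C₁ h^{2s} λ_{ℓ+1}^{−1} for all 1 ≤ ℓ ≤ L; (ii) ‖E[S] − Σ‖₂ ≤ Δ/(16 λ_W); (iii) Δ/(16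 λ_W) < ρ₁; (iv) for every t ∈ (0, ρ₁), P(‖S − E[S]‖₂ > t) ≤ 2p·5^τ·exp(−M t² ρ₁ / 9). Then with probability at least 1 − 2p·5^τ·exp(−M ρ₁ (Δ/(48 λ_W))²) it holds that δ_ℓ ≥ 4 C₁ h^{2s} λ_{ℓ+1}^{−1} + 4‖L̃ᵀ(S − Σ)L̃‖₂ for all 1 ≤ ℓ ≤ L. -/
open MeasureTheory

/-- The spectral norm of a real square matrix: the operator norm of the induced
endomorphism of Euclidean space. -/
noncomputable def specNorm {n : ℕ} (A : Matrix (Fin n) (Fin n) ℝ) : ℝ :=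
  ‖Matrix.toEuclideanCLM (𝕜 := ℝ) A‖

open scoped Matrix.Norms.L2Operator in
theorem specNorm_eq_norm {n : ℕ} (A : Matrix (Fin n) (Fin n) ℝ) : specNorm A = ‖A‖ := rfl

open scoped Matrix.Norms.L2Operator in
/-- The spectral norm of a positive definite matrix is bounded by any upper bound of its
eigenvalues. -/
theorem Matrix.PosDef.specNorm_le {n : ℕ} {W : Matrix (Fin n) (Fin n) ℝ} (hW : W.PosDef) {c : ℝ}
    (hc : 0 ≤ c) (h : ∀ i, hW.isHermitian.eigenvalues i ≤ c) : specNorm W ≤ c := by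
  rw [specNorm_eq_norm, hW.isHermitian.spectral_theorem, Unitary.conjStarAlgAut_apply,
    ← Unitary.coe_star, CStarRing.norm_mul_coe_unitary, CStarRing.norm_coe_unitary_mul,
    Matrix.l2_opNorm_diagonal, pi_norm_le_iff_of_nonneg hc]
  intro i
  simpa [abs_of_pos (hW.eigenvalues_pos i)] using h i

open scoped Matrix.Norms.L2Operator in
/-- Congruence by a factor `B` scales the spectral norm by at most `‖B Bᵀ‖`. -/
theorem specNorm_transpose_mul_mul_le {n : ℕ} (A B : Matrix (Fin n) (Fin n) ℝ) :
    specNorm (B.transpose * A * B) ≤ specNorm (B * B.transpose) * specNorm A := by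
  simp only [specNorm_eq_norm, ← Matrix.conjTranspose_eq_transpose_of_trivial,
    ← Matrix.star_eq_conjTranspose]
  rw [CStarRing.norm_self_mul_star]
  calc ‖star B * A * B‖ ≤ ‖star B‖ * ‖A‖ * ‖B‖ := norm_mul₃_le
    _ = ‖B‖ * ‖B‖ * ‖A‖ := by rw [norm_star]; ring

open scoped Matrix.Norms.L2Operator in
theorem specNorm_sub_le_add {n : ℕ} (A B C : Matrix (Fin n) (Fin n) ℝ) :
    specNorm (A - C) ≤ specNorm (A - B) + specNorm (B - C) :=
  norm_sub_le_norm_sub_add_norm_sub A B C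

theorem specNorm_nonneg {n : ℕ} (A : Matrix (Fin n) (Fin n) ℝ) : 0 ≤ specNorm A :=
  norm_nonneg _

/-- If the complement of `G` lies in an event of probability at most `c`, then `G` has
probability at least `1 - c`. -/
theorem one_sub_le_toReal_of_compl_subset {Ω : Type*} [MeasurableSpace Ω] {P : Measure Ω}
    [IsProbabilityMeasure P] {G B : Set Ω} (hGB : Gᶜ ⊆ B) {c : ℝ} (hc : 0 ≤ c)
    (hB : P B ≤ ENNReal.ofReal c) : 1 - c ≤ (P G).toReal := by
  have hB' : P.real Gᶜ ≤ c := ENNReal.toReal_le_of_le_ofReal hc ((measure_mono hGB).trans hB)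
  have hu : P.real (G ∪ Gᶜ) ≤ P.real G + P.real Gᶜ := measureReal_union_le G Gᶜ
  rw [Set.union_compl_self, probReal_univ] at hu
  change 1 - c ≤ P.real G
  linarith

/-- **Spectral gap condition holds with high probability** (paper Proposition 3.7).
`S` is the (random) tapering estimator of the covariance matrix `Sig`, `W = Lt Ltᵀ` the
symmetric positive definite mass matrix with largest eigenvalue `lamW`, `δ_ℓ` (indexed here
by `0 ≤ ℓ < L`, corresponding to `1 ≤ ℓ ≤ L` in the paper) the continuous spectral gaps with
minimum `Δmin`, and `lam (ℓ+1)` the continuous eigenvalues `λ_{ℓ+1}`.  Under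
(i) `δ_ℓ ≥ 8 C₁ h^{2s} λ_{ℓ+1}⁻¹`, (ii) `‖E[S] − Sig‖₂ ≤ Δmin/(16 lamW)`,
(iii) `Δmin/(16 lamW) < ρ₁`, and the concentration inequality (iv), the spectral gap
condition `δ_ℓ ≥ 4 C₁ h^{2s} λ_{ℓ+1}⁻¹ + 4 ‖Ltᵀ(S − Sig)Lt‖₂` for all `ℓ` holds with
probability at least `1 − 2p·5^τ·exp(−M ρ₁ (Δmin/(48 lamW))²)`. -/
theorem spectral_gap_high_probability
    {Ω : Type*} [MeasurableSpace Ω] (P : Measure Ω) [IsProbabilityMeasure P]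
    (p M L τ : ℕ) (hp : 0 < p) (hM : 0 < M) (hL : 0 < L) (hτ : 0 < τ)
    (ρ₁ : ℝ) (hρ₁ : 0 < ρ₁)
    (S : Ω → Matrix (Fin p) (Fin p) ℝ)
    (hSmeas : ∀ i j, Measurable fun ω => S ω i j)
    (hSint : ∀ i j, Integrable (fun ω => S ω i j) P)
    (hSsym : ∀ ω, (S ω).IsHermitian)
    (ES : Matrix (Fin p) (Fin p) ℝ)
    (hES : ∀ i j, ES i j = ∫ ω, S ω i j ∂P)
    (Sig : Matrix (Fin p) (Fin p) ℝ) (hSig : Sig.IsHermitian)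
    (W Lt : Matrix (Fin p) (Fin p) ℝ)
    (hW : W.PosDef) (hfact : W = Lt * Lt.transpose)
    (lamW : ℝ) (hlamW : IsGreatest (Set.range hW.isHermitian.eigenvalues) lamW)
    (δ : ℕ → ℝ) (hδpos : ∀ ℓ < L, 0 < δ ℓ)
    (Δmin : ℝ) (hΔmin : IsLeast (δ '' {ℓ | ℓ < L}) Δmin)
    (lam : ℕ → ℝ) (hlampos : ∀ ℓ, 1 ≤ ℓ → ℓ ≤ L → 0 < lam ℓ)
    (C₁ h s : ℝ) (hC₁ : 0 < C₁) (hh : 0 < h) (hs : 0 < s)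
    (cond1 : ∀ ℓ < L, 8 * C₁ * h ^ (2 * s) * (lam (ℓ + 1))⁻¹ ≤ δ ℓ)
    (cond2 : specNorm (ES - Sig) ≤ Δmin / (16 * lamW))
    (cond3 : Δmin / (16 * lamW) < ρ₁)
    (cond4 : ∀ t : ℝ, 0 < t → t < ρ₁ →
      P {ω | t < specNorm (S ω - ES)} ≤
        ENNReal.ofReal (2 * p * 5 ^ τ * Real.exp (-(M * t ^ 2 * ρ₁) / 9))) :
    1 - 2 * p * 5 ^ τ * Real.exp (-(M * ρ₁) * (Δmin / (48 * lamW)) ^ 2) ≤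
      (P {ω | ∀ ℓ < L,
        4 * C₁ * h ^ (2 * s) * (lam (ℓ + 1))⁻¹ +
          4 * specNorm (Lt.transpose * (S ω - Sig) * Lt) ≤ δ ℓ}).toReal := by
  have hlamW_pos : 0 < lamW := by
    obtain ⟨i, hi⟩ := hlamW.1
    exact hi ▸ hW.eigenvalues_pos i
  have hΔ_pos : 0 < Δmin := by
    obtain ⟨ℓ, hℓ, rfl⟩ := hΔmin.1
    exact hδpos ℓ hℓ
  have hW_le : specNorm (Lt * Lt.transpose) ≤ lamW :=
    hfact ▸ hW.specNorm_le hlamW_pos.le fun i => hlamW.2 ⟨i, rfl⟩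
  have hconc := cond4 (Δmin / (16 * lamW)) (by positivity) cond3
  have hexp : -(M * (Δmin / (16 * lamW)) ^ 2 * ρ₁) / 9 =
      -(M * ρ₁) * (Δmin / (48 * lamW)) ^ 2 := by
    field_simp
    norm_num
  rw [hexp] at hconc
  refine one_sub_le_toReal_of_compl_subset (Set.compl_subset_comm.1 ?_) (by positivity) hconc
  intro ω hω ℓ hℓ
  have hω' : specNorm (S ω - ES) ≤ Δmin / (16 * lamW) := not_lt.1 hω
  have hdev : specNorm (S ω - Sig) ≤ Δmin / (8 * lamW) := by
    refine (specNorm_sub_le_add (S ω) ES Sig).trans ((add_le_add hω' cond2).trans_eq ?_)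
    field_simp
    norm_num
  have hcongr : specNorm (Lt.transpose * (S ω - Sig) * Lt) ≤ Δmin / 8 := by
    refine (specNorm_transpose_mul_mul_le _ _).trans
      ((mul_le_mul hW_le hdev (specNorm_nonneg _) hlamW_pos.le).trans_eq ?_)
    field_simp
  have hΔ_le : Δmin ≤ δ ℓ := hΔmin.2 ⟨ℓ, hℓ, rfl⟩
  linarith [cond1 ℓ hℓ]
end

section
/- Let p be a positive integer, α, C₁, C₂ > 0, and let Σ be a symmetric p×p real matrix in the class F_α(C₁,C₂). Let τ be an even integer with 2 ≤ τ ≤ 2p, and define the tapered matrix T entrywise by T_{ij} := w_{ij}(τ)·Σ_{ij}. Then ‖T − Σ‖₂ ≤ C₁·(τ/2)^{−α}. -/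
/-- The tapering weights `w_{ij}(τ)`: `1` if `|i−j| ≤ τ/2`, `2(1 − |i−j|/τ)` if
`τ/2 < |i−j| < τ`, and `0` if `|i−j| ≥ τ` (for `τ` even, `2|i−j| ≤ τ ↔ |i−j| ≤ τ/2`). -/
noncomputable def taperWeight (τ i j : ℕ) : ℝ :=
  if 2 * |(i : ℤ) - (j : ℤ)| ≤ (τ : ℤ) then 1
  else if |(i : ℤ) - (j : ℤ)| < (τ : ℤ) then
    2 * (1 - (|(i : ℤ) - (j : ℤ)| : ℝ) / (τ : ℝ))
  else 0

/-- Schur test: a matrix whose absolute row and column sums are at most `K` has spectral norm at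
most `K`. -/
theorem specNorm_le_of_sum_abs_le {n : ℕ} (A : Matrix (Fin n) (Fin n) ℝ) {K : ℝ} (hK : 0 ≤ K)
    (hrow : ∀ i, ∑ j, |A i j| ≤ K) (hcol : ∀ j, ∑ i, |A i j| ≤ K) : specNorm A ≤ K := by
  refine ContinuousLinearMap.opNorm_le_bound _ hK fun x => ?_
  refine le_of_sq_le_sq ?_ (by positivity)
  rw [mul_pow, EuclideanSpace.real_norm_sq_eq, EuclideanSpace.real_norm_sq_eq]
  have hentry (i : Fin n) :
      (Matrix.toEuclideanCLM (𝕜 := ℝ) A x) i ^ 2 ≤ K * ∑ j, |A i j| * x j ^ 2 := by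
    have happly : (Matrix.toEuclideanCLM (𝕜 := ℝ) A x) i = ∑ j, A i j * x j := rfl
    rw [happly]
    refine (Finset.sum_sq_le_sum_mul_sum_of_sq_le_mul Finset.univ
      (f := fun j => |A i j|) (g := fun j => |A i j| * x j ^ 2)
      (fun j _ => abs_nonneg _) (fun j _ => by positivity) fun j _ => ?_).trans ?_
    · rw [mul_pow, ← sq_abs (A i j), sq, mul_assoc]
    · exact mul_le_mul_of_nonneg_right (hrow i) (Finset.sum_nonneg fun j _ => by positivity)
  calc ∑ i, (Matrix.toEuclideanCLM (𝕜 := ℝ) A x) i ^ 2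
      ≤ ∑ i, K * ∑ j, |A i j| * x j ^ 2 := Finset.sum_le_sum fun i _ => hentry i
    _ = K * ∑ j, (∑ i, |A i j|) * x j ^ 2 := by
        rw [← Finset.mul_sum, Finset.sum_comm]
        simp only [Finset.sum_mul]
    _ ≤ K * ∑ j, K * x j ^ 2 := by
        gcongr with j
        exact hcol j
    _ = K ^ 2 * ∑ j, x j ^ 2 := by
        rw [← Finset.mul_sum]
        ring

theorem taperWeight_comm (τ i j : ℕ) : taperWeight τ i j = taperWeight τ j i := by
  simp only [taperWeight, abs_sub_comm (i : ℤ), abs_sub_comm ((i : ℤ) : ℝ)]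

theorem taperWeight_eq_one {τ i j : ℕ} (h : 2 * |(i : ℤ) - (j : ℤ)| ≤ τ) :
    taperWeight τ i j = 1 := if_pos h

theorem abs_taperWeight_sub_one_le (τ i j : ℕ) : |taperWeight τ i j - 1| ≤ 1 := by
  unfold taperWeight
  split_ifs with h₁ h₂
  · simp
  · have h₁r : (τ : ℝ) < 2 * |((i : ℤ) : ℝ) - ((j : ℤ) : ℝ)| := by exact_mod_cast not_le.mp h₁
    have h₂r : |((i : ℤ) : ℝ) - ((j : ℤ) : ℝ)| < (τ : ℝ) := by exact_mod_cast h₂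
    have hτ : (0 : ℝ) < τ := (abs_nonneg _).trans_lt h₂r
    have hlow : 1 / 2 ≤ |((i : ℤ) : ℝ) - ((j : ℤ) : ℝ)| / τ := by
      rw [le_div_iff₀ hτ]
      linarith
    have hupp : |((i : ℤ) : ℝ) - ((j : ℤ) : ℝ)| / τ ≤ 1 := (div_le_one hτ).mpr h₂r.le
    rw [abs_le]
    constructor <;> linarith
  · simp

/-- **Bias bound for the tapering estimator** (paper estimate (3.28)).
If `S` is a symmetric `p×p` matrix in the class `F_α(C₁,C₂)` (off-diagonal decay of rate `α`
with constant `C₁`, largest eigenvalue at most `C₂`), `τ` is even with `2 ≤ τ ≤ 2p`, and `T`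
is the tapered matrix `T_{ij} = w_{ij}(τ) S_{ij}`, then `‖T − S‖₂ ≤ C₁ (τ/2)^{-α}`. -/
theorem tapering_bias_bound
    (p : ℕ) (hp : 0 < p) (α C₁ C₂ : ℝ) (hα : 0 < α) (hC₁ : 0 < C₁) (hC₂ : 0 < C₂)
    (S : Matrix (Fin p) (Fin p) ℝ) (hsym : S.IsHermitian)
    (hdecay : ∀ c : ℕ, 1 ≤ c → c ≤ p → ∀ j : Fin p,
      ∑ i ∈ Finset.univ.filter (fun i : Fin p => (c : ℤ) < |(i : ℤ) - (j : ℤ)|), |S i j|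
        ≤ C₁ * (c : ℝ) ^ (-α))
    (heig : ∀ i, hsym.eigenvalues i ≤ C₂)
    (τ : ℕ) (hτeven : Even τ) (hτ2 : 2 ≤ τ) (hτp : τ ≤ 2 * p) :
    specNorm (Matrix.of (fun i j : Fin p => taperWeight τ i j * S i j) - S)
      ≤ C₁ * ((τ : ℝ) / 2) ^ (-α) := by
  obtain ⟨c, rfl⟩ := hτeven
  have hc : ((c + c : ℕ) : ℝ) / 2 = c := by
    push_cast
    ring
  rw [hc]
  have hcol (j : Fin p) :
      ∑ i, |(Matrix.of (fun i j : Fin p => taperWeight (c + c) i j * S i j) - S) i j|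
        ≤ C₁ * (c : ℝ) ^ (-α) := by
    refine le_trans ?_ (hdecay c (by omega) (by omega) j)
    rw [Finset.sum_filter]
    refine Finset.sum_le_sum fun i _ => ?_
    rw [Matrix.sub_apply, Matrix.of_apply, ← sub_one_mul, abs_mul]
    split_ifs with h
    · exact mul_le_of_le_one_left (abs_nonneg _) (abs_taperWeight_sub_one_le _ _ _)
    · rw [taperWeight_eq_one (by
        push_cast
        linarith)]
      simp
  refine specNorm_le_of_sum_abs_le _ (by positivity) (fun i => ?_) hcol
  refine le_of_eq_of_le (Finset.sum_congr rfl fun j _ => ?_) (hcol i)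
  have hS : S i j = S j i := hsym.apply j i
  simp only [Matrix.sub_apply, Matrix.of_apply, taperWeight_comm (c + c) i j, hS]
end

section
/- Let (D,μ) be a σ-finite measure space, L a positive integer, and (φ_ℓ)_{ℓ=1}^L, (u_ℓ)_{ℓ=1}^L two orthonormal families in L²(μ;ℝ). Let C₁, C₂, η > 0 and reals λ_ℓ, λ^h_ℓ with 0 ≤ λ^h_ℓ ≤ λ_ℓ, λ_ℓ > 0, |λ_ℓ − λ^h_ℓ| ≤ C₁ λ_ℓ^{−1} η², ‖φ_ℓ − u_ℓ‖_{L²(μ)} ≤ C₂ λ_ℓ^{−1} η, and C₂ η ≤ λ_ℓ for all 1 ≤ ℓ ≤ L. Then ‖Σ_{ℓ=1}^L λ_ℓ (φ_ℓ ⊗ φ_ℓ) − Σ_{ℓ=1}^L λ^h_ℓ (u_ℓ ⊗ u_ℓ)‖_{L²(μ⊗μ)} ≤ (C₁/C₂ + 2C₂)·L^{1/2}·η. -/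
open MeasureTheory

section TensorLp

variable {α β : Type*} [MeasurableSpace α] [MeasurableSpace β] {μ : Measure α} {ν : Measure β}

/-- The function `(x, y) ↦ f x * g y` is square integrable if `f` and `g` are. -/
theorem memLp_two_mul_prod {f : α → ℝ} {g : β → ℝ} (hf : MemLp f 2 μ) (hg : MemLp g 2 ν) :
    MemLp (fun z : α × β => f z.1 * g z.2) 2 (μ.prod ν) := by
  refine (memLp_two_iff_integrable_sq
    (hf.aestronglyMeasurable.comp_fst.mul hg.aestronglyMeasurable.comp_snd)).2 ?_
  simpa only [Pi.mul_apply, mul_pow] using hf.integrable_sq.mul_prod hg.integrable_sq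

/-- The tensor product `f ⊗ g` of two square integrable functions, `(x, y) ↦ f x * g y`. -/
noncomputable def tensorLp (f : Lp ℝ 2 μ) (g : Lp ℝ 2 ν) : Lp ℝ 2 (μ.prod ν) :=
  (memLp_two_mul_prod (Lp.memLp f) (Lp.memLp g)).toLp _

theorem coeFn_tensorLp (f : Lp ℝ 2 μ) (g : Lp ℝ 2 ν) :
    tensorLp f g =ᵐ[μ.prod ν] fun z => f z.1 * g z.2 :=
  MemLp.coeFn_toLp _

theorem tensorLp_sub_left (f f' : Lp ℝ 2 μ) (g : Lp ℝ 2 ν) :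
    tensorLp (f - f') g = tensorLp f g - tensorLp f' g := by
  apply Lp.ext
  filter_upwards [coeFn_tensorLp (f - f') g, coeFn_tensorLp f g, coeFn_tensorLp f' g,
    Lp.coeFn_sub (tensorLp f g) (tensorLp f' g),
    (Measure.quasiMeasurePreserving_fst (μ := μ) (ν := ν)).ae (Lp.coeFn_sub f f')]
    with z h₁ h₂ h₃ h₄ h₅
  rw [h₄, Pi.sub_apply, h₁, h₂, h₃, h₅, Pi.sub_apply, sub_mul]

theorem tensorLp_sub_right (f : Lp ℝ 2 μ) (g g' : Lp ℝ 2 ν) :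
    tensorLp f (g - g') = tensorLp f g - tensorLp f g' := by
  apply Lp.ext
  filter_upwards [coeFn_tensorLp f (g - g'), coeFn_tensorLp f g, coeFn_tensorLp f g',
    Lp.coeFn_sub (tensorLp f g) (tensorLp f g'),
    (Measure.quasiMeasurePreserving_snd (μ := μ) (ν := ν)).ae (Lp.coeFn_sub g g')]
    with z h₁ h₂ h₃ h₄ h₅
  rw [h₄, Pi.sub_apply, h₁, h₂, h₃, h₅, Pi.sub_apply, mul_sub]

variable [SFinite μ] [SFinite ν]

theorem inner_tensorLp (f f' : Lp ℝ 2 μ) (g g' : Lp ℝ 2 ν) :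
    inner ℝ (tensorLp f g) (tensorLp f' g') = inner ℝ f f' * inner ℝ g g' := by
  rw [L2.inner_def, L2.inner_def, L2.inner_def, ← integral_prod_mul]
  apply integral_congr_ae
  filter_upwards [coeFn_tensorLp f g, coeFn_tensorLp f' g'] with z h h'
  simp only [h, h', RCLike.inner_apply, conj_trivial]
  ring

theorem norm_tensorLp (f : Lp ℝ 2 μ) (g : Lp ℝ 2 ν) : ‖tensorLp f g‖ = ‖f‖ * ‖g‖ := by
  rw [← sq_eq_sq₀ (norm_nonneg _) (by positivity), mul_pow, ← real_inner_self_eq_norm_sq,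
    inner_tensorLp, real_inner_self_eq_norm_sq, real_inner_self_eq_norm_sq]

end TensorLp

/-- Pythagoras: the norm of a sum of pairwise orthogonal vectors of norm at most `M` is at most
`√n * M`, where `n` is the number of vectors. -/
theorem norm_sum_le_sqrt_card_mul_of_pairwise_inner_eq_zero {ι E : Type*} [NormedAddCommGroup E]
    [InnerProductSpace ℝ E] {s : Finset ι} {v : ι → E} {M : ℝ} (hM : 0 ≤ M)
    (hv : ∀ i ∈ s, ∀ j ∈ s, i ≠ j → inner ℝ (v i) (v j) = 0) (hvM : ∀ i ∈ s, ‖v i‖ ≤ M) :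
    ‖∑ i ∈ s, v i‖ ≤ √(s.card : ℝ) * M := by
  have hsq : ‖∑ i ∈ s, v i‖ ^ 2 = ∑ i ∈ s, ‖v i‖ ^ 2 := by
    rw [← real_inner_self_eq_norm_sq, sum_inner]
    refine Finset.sum_congr rfl fun i hi => ?_
    rw [inner_sum, Finset.sum_eq_single_of_mem i hi fun j hj hji => hv i hi j hj hji.symm,
      real_inner_self_eq_norm_sq]
  refine (sq_le_sq₀ (norm_nonneg _) (by positivity)).1 ?_
  rw [hsq, mul_pow, Real.sq_sqrt (Nat.cast_nonneg _), ← nsmul_eq_mul]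
  exact Finset.sum_le_card_nsmul _ _ _ fun i hi =>
    pow_le_pow_left₀ (norm_nonneg _) (hvM i hi) 2

/-- **Spatial discretization error bound** (paper Theorem 4.1, bound (4.12) on
`E₂ = R^{(L)} − R^{(L;h)}`).  Families are indexed by `ℕ`, with index `ℓ` corresponding to
`ℓ + 1` in the paper; `Tφ ℓ = φ_ℓ ⊗ φ_ℓ` and `Tu ℓ = u_ℓ ⊗ u_ℓ` in `L²(μ ⊗ μ)`, `η = h^s`. -/
theorem spatial_discretization_error
    {D : Type*} [MeasurableSpace D] (μ : Measure D) [SigmaFinite μ]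
    (L : ℕ) (hL : 0 < L)
    (φ u : ℕ → Lp ℝ 2 μ)
    (hφ : Orthonormal ℝ (fun i : Fin L => φ i))
    (hu : Orthonormal ℝ (fun i : Fin L => u i))
    (C₁ C₂ η : ℝ) (hC₁ : 0 < C₁) (hC₂ : 0 < C₂) (hη : 0 < η)
    (lam lamh : ℕ → ℝ)
    (hlam_pos : ∀ ℓ < L, 0 < lam ℓ)
    (hlamh_nonneg : ∀ ℓ < L, 0 ≤ lamh ℓ)
    (hlamh_le : ∀ ℓ < L, lamh ℓ ≤ lam ℓ)
    (heig_err : ∀ ℓ < L, |lam ℓ - lamh ℓ| ≤ C₁ * (lam ℓ)⁻¹ * η ^ 2)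
    (hfun_err : ∀ ℓ < L, ‖φ ℓ - u ℓ‖ ≤ C₂ * (lam ℓ)⁻¹ * η)
    (hres : ∀ ℓ < L, C₂ * η ≤ lam ℓ)
    (Tφ Tu : ℕ → Lp ℝ 2 (μ.prod μ))
    (hTφ : ∀ ℓ < L, ⇑(Tφ ℓ) =ᵐ[μ.prod μ] fun z : D × D => φ ℓ z.1 * φ ℓ z.2)
    (hTu : ∀ ℓ < L, ⇑(Tu ℓ) =ᵐ[μ.prod μ] fun z : D × D => u ℓ z.1 * u ℓ z.2) :
    ‖∑ ℓ ∈ Finset.range L, lam ℓ • Tφ ℓ - ∑ ℓ ∈ Finset.range L, lamh ℓ • Tu ℓ‖ ≤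
      (C₁ / C₂ + 2 * C₂) * (L : ℝ) ^ ((1 : ℝ) / 2) * η := by
  have inner_eq_zero_of_ne {w : ℕ → Lp ℝ 2 μ} (hw : Orthonormal ℝ fun i : Fin L => w i)
      {i j : ℕ} (hi : i < L) (hj : j < L) (hij : i ≠ j) : inner ℝ (w i) (w j) = 0 :=
    hw.2 (i := ⟨i, hi⟩) (j := ⟨j, hj⟩) (by simpa using hij)
  have hφ_norm (i : ℕ) (hi : i < L) : ‖φ i‖ = 1 := hφ.1 ⟨i, hi⟩
  have hu_norm (i : ℕ) (hi : i < L) : ‖u i‖ = 1 := hu.1 ⟨i, hi⟩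
  have hTφ_eq (i : ℕ) (hi : i < L) : Tφ i = tensorLp (φ i) (φ i) :=
    Lp.ext ((hTφ i hi).trans (coeFn_tensorLp _ _).symm)
  have hTu_eq (i : ℕ) (hi : i < L) : Tu i = tensorLp (u i) (u i) :=
    Lp.ext ((hTu i hi).trans (coeFn_tensorLp _ _).symm)
  have hdecomp : ∑ i ∈ Finset.range L, lam i • Tφ i - ∑ i ∈ Finset.range L, lamh i • Tu i =
      ∑ i ∈ Finset.range L, (lam i - lamh i) • tensorLp (u i) (u i) +
      ∑ i ∈ Finset.range L, lam i • tensorLp (φ i) (φ i - u i) +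
      ∑ i ∈ Finset.range L, lam i • tensorLp (φ i - u i) (u i) := by
    rw [← Finset.sum_sub_distrib, ← Finset.sum_add_distrib, ← Finset.sum_add_distrib]
    refine Finset.sum_congr rfl fun i hi => ?_
    rw [hTφ_eq i (Finset.mem_range.1 hi), hTu_eq i (Finset.mem_range.1 hi),
      tensorLp_sub_left, tensorLp_sub_right]
    module
  have hscaled (i : ℕ) (hi : i < L) : lam i * ‖φ i - u i‖ ≤ C₂ * η := by
    have hpos := hlam_pos i hi
    calc lam i * ‖φ i - u i‖ ≤ lam i * (C₂ * (lam i)⁻¹ * η) := by gcongr; exact hfun_err i hi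
      _ = C₂ * η := by field_simp
  have heig : ‖∑ i ∈ Finset.range L, (lam i - lamh i) • tensorLp (u i) (u i)‖ ≤
      √(L : ℝ) * (C₁ / C₂ * η) := by
    conv_rhs => rw [← Finset.card_range L]
    refine norm_sum_le_sqrt_card_mul_of_pairwise_inner_eq_zero (by positivity) ?_ ?_ <;>
      simp only [Finset.mem_range]
    · intro i hi j hj hij
      simp [inner_smul_left, inner_smul_right, inner_tensorLp, inner_eq_zero_of_ne hu hi hj hij]
    · intro i hi
      have hpos := hlam_pos i hi
      rw [norm_smul, norm_tensorLp, hu_norm i hi, mul_one, mul_one, Real.norm_eq_abs]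
      refine (heig_err i hi).trans ?_
      rw [← div_eq_mul_inv, div_mul_eq_mul_div, div_mul_eq_mul_div,
        div_le_div_iff₀ hpos hC₂]
      nlinarith [mul_le_mul_of_nonneg_left (hres i hi) (mul_pos hC₁ hη).le]
  have hright : ‖∑ i ∈ Finset.range L, lam i • tensorLp (φ i) (φ i - u i)‖ ≤
      √(L : ℝ) * (C₂ * η) := by
    conv_rhs => rw [← Finset.card_range L]
    refine norm_sum_le_sqrt_card_mul_of_pairwise_inner_eq_zero (by positivity) ?_ ?_ <;>
      simp only [Finset.mem_range]
    · intro i hi j hj hij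
      simp [inner_smul_left, inner_smul_right, inner_tensorLp, inner_eq_zero_of_ne hφ hi hj hij]
    · intro i hi
      rw [norm_smul, norm_tensorLp, hφ_norm i hi, one_mul, Real.norm_of_nonneg (hlam_pos i hi).le]
      exact hscaled i hi
  have hleft : ‖∑ i ∈ Finset.range L, lam i • tensorLp (φ i - u i) (u i)‖ ≤
      √(L : ℝ) * (C₂ * η) := by
    conv_rhs => rw [← Finset.card_range L]
    refine norm_sum_le_sqrt_card_mul_of_pairwise_inner_eq_zero (by positivity) ?_ ?_ <;>
      simp only [Finset.mem_range]
    · intro i hi j hj hij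
      simp [inner_smul_left, inner_smul_right, inner_tensorLp, inner_eq_zero_of_ne hu hi hj hij]
    · intro i hi
      rw [norm_smul, norm_tensorLp, hu_norm i hi, mul_one, Real.norm_of_nonneg (hlam_pos i hi).le]
      exact hscaled i hi
  rw [hdecomp, ← Real.sqrt_eq_rpow]
  refine norm_add₃_le.trans ((add_le_add_three heig hright hleft).trans_eq ?_)
  ring
end

section
/- Let (D,μ) be a σ-finite measure space, L a positive integer, and (u_ℓ)_{ℓ=1}^L, (v_ℓ)_{ℓ=1}^L two orthonormal families in L²(μ;ℝ). Let C > 0, E ≥ 0, and reals a_ℓ, b_ℓ, λ_ℓ, δ_ℓ with 0 ≤ a_ℓ ≤ λ_ℓ, |a_ℓ − b_ℓ| ≤ E, δ_ℓ > 0, δ_ℓ ≥ 4E, and ‖u_ℓ − v_ℓ‖_{L²(μ)} ≤ 4C δ_ℓ^{−1} E for all 1 ≤ ℓ ≤ L. Then, with G(L) := (Σ_{ℓ=1}^L (δ_ℓ^{−1} λ_ℓ)²)^{1/2}, it holds that ‖Σ_{ℓ=1}^L a_ℓ (u_ℓ ⊗ u_ℓ) − Σ_{ℓ=1}^L b_ℓ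 (v_ℓ ⊗ v_ℓ)‖_{L²(μ⊗μ)} ≤ E·((1 + √2·C)·L^{1/2} + 4√2·C·G(L)). -/
open MeasureTheory

/-- The inner product of two pure tensors `f ⊗ f` and `g ⊗ g` in `L²(μ ⊗ μ)`. -/
theorem inner_tensor_self_eq_sq {D : Type*} [MeasurableSpace D] (μ : Measure D) [SigmaFinite μ]
    {f g : Lp ℝ 2 μ} {S T : Lp ℝ 2 (μ.prod μ)}
    (hS : ⇑S =ᵐ[μ.prod μ] fun z : D × D => f z.1 * f z.2)
    (hT : ⇑T =ᵐ[μ.prod μ] fun z : D × D => g z.1 * g z.2) :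
    inner ℝ S T = (inner ℝ f g) ^ 2 := by
  rw [L2.inner_def, L2.inner_def, sq, ← integral_prod_mul]
  refine integral_congr_ae ?_
  filter_upwards [hS, hT] with z hz hz'
  simp only [hz, hz', RCLike.inner_apply, conj_trivial]
  ring

/-- Vectors with pairwise nonpositive inner products satisfy a Bessel-type bound for
combinations with nonnegative coefficients. -/
theorem norm_sq_sum_smul_le_of_inner_nonpos {H ι : Type*} [NormedAddCommGroup H]
    [InnerProductSpace ℝ H] (s : Finset ι) (a : ι → ℝ) (x : ι → H)
    (ha : ∀ i ∈ s, 0 ≤ a i)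
    (hx : ∀ i ∈ s, ∀ j ∈ s, i ≠ j → inner ℝ (x i) (x j) ≤ 0) :
    ‖∑ i ∈ s, a i • x i‖ ^ 2 ≤ ∑ i ∈ s, (a i * ‖x i‖) ^ 2 := by
  classical
  rw [← real_inner_self_eq_norm_sq, sum_inner]
  refine Finset.sum_le_sum fun i hi => ?_
  rw [inner_sum, ← Finset.add_sum_erase s _ hi]
  have h_off : ∑ j ∈ s.erase i, inner ℝ (a i • x i) (a j • x j) ≤ 0 := by
    refine Finset.sum_nonpos fun j hj => ?_
    rw [real_inner_smul_left, real_inner_smul_right]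
    have hj' := Finset.mem_of_mem_erase hj
    exact mul_nonpos_of_nonneg_of_nonpos (ha i hi) <|
      mul_nonpos_of_nonneg_of_nonpos (ha j hj') (hx i hi j hj' (Finset.ne_of_mem_erase hj).symm)
  have h_diag : inner ℝ (a i • x i) (a i • x i) = (a i * ‖x i‖) ^ 2 := by
    rw [real_inner_smul_left, real_inner_smul_right, real_inner_self_eq_norm_sq]
    ring
  linarith

/-- **Sampling error bound** (paper Theorem 4.1, bound (4.18) on
`E₃ = R^{(L;h)} − R^{(L;h;M)}`).  Families are indexed by `ℕ`, with index `ℓ` corresponding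
to `ℓ + 1` in the paper; `Tu ℓ = u_ℓ ⊗ u_ℓ` and `Tv ℓ = v_ℓ ⊗ v_ℓ` in `L²(μ ⊗ μ)`;
`a_ℓ, u_ℓ` are the Galerkin eigenpairs, `b_ℓ, v_ℓ` the sampled eigenpairs, `E` the
transformed covariance matrix error, `λ_ℓ` the continuous eigenvalues and `δ_ℓ` the
continuous spectral gaps; `G(L) = (∑_{ℓ=1}^L (δ_ℓ⁻¹ λ_ℓ)²)^{1/2}`. -/
theorem sampling_error_bound
    {D : Type*} [MeasurableSpace D] (μ : Measure D) [SigmaFinite μ]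
    (L : ℕ) (hL : 0 < L)
    (u v : ℕ → Lp ℝ 2 μ)
    (hu : Orthonormal ℝ (fun i : Fin L => u i))
    (hv : Orthonormal ℝ (fun i : Fin L => v i))
    (C E : ℝ) (hC : 0 < C) (hE : 0 ≤ E)
    (a b lam δ : ℕ → ℝ)
    (ha_nonneg : ∀ ℓ < L, 0 ≤ a ℓ)
    (ha_le : ∀ ℓ < L, a ℓ ≤ lam ℓ)
    (hab : ∀ ℓ < L, |a ℓ - b ℓ| ≤ E)
    (hδ_pos : ∀ ℓ < L, 0 < δ ℓ)
    (hδE : ∀ ℓ < L, 4 * E ≤ δ ℓ)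
    (huv : ∀ ℓ < L, ‖u ℓ - v ℓ‖ ≤ 4 * C * (δ ℓ)⁻¹ * E)
    (Tu Tv : ℕ → Lp ℝ 2 (μ.prod μ))
    (hTu : ∀ ℓ < L, ⇑(Tu ℓ) =ᵐ[μ.prod μ] fun z : D × D => u ℓ z.1 * u ℓ z.2)
    (hTv : ∀ ℓ < L, ⇑(Tv ℓ) =ᵐ[μ.prod μ] fun z : D × D => v ℓ z.1 * v ℓ z.2) :
    ‖∑ ℓ ∈ Finset.range L, a ℓ • Tu ℓ - ∑ ℓ ∈ Finset.range L, b ℓ • Tv ℓ‖ ≤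
      E * ((1 + Real.sqrt 2 * C) * (L : ℝ) ^ ((1 : ℝ) / 2) +
        4 * Real.sqrt 2 * C *
          Real.sqrt (∑ ℓ ∈ Finset.range L, ((δ ℓ)⁻¹ * lam ℓ) ^ 2)) := by
  have huu : ∀ i < L, ∀ j < L, i ≠ j → inner ℝ (u i) (u j) = 0 := fun i hi j hj hij =>
    hu.2 (i := ⟨i, hi⟩) (j := ⟨j, hj⟩) (by simpa using hij)
  have hvv : ∀ i < L, ∀ j < L, i ≠ j → inner ℝ (v i) (v j) = 0 := fun i hi j hj hij =>
    hv.2 (i := ⟨i, hi⟩) (j := ⟨j, hj⟩) (by simpa using hij)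
  have hu1 : ∀ i < L, ‖u i‖ = 1 := fun i hi => hu.1 ⟨i, hi⟩
  have hv1 : ∀ i < L, ‖v i‖ = 1 := fun i hi => hv.1 ⟨i, hi⟩
  have h_inner : ∀ i < L, ∀ j < L, inner ℝ (Tu i - Tv i) (Tu j - Tv j) =
      inner ℝ (u i) (u j) ^ 2 - inner ℝ (u i) (v j) ^ 2
        - (inner ℝ (v i) (u j) ^ 2 - inner ℝ (v i) (v j) ^ 2) := by
    intro i hi j hj
    rw [inner_sub_left, inner_sub_right, inner_sub_right,
      inner_tensor_self_eq_sq μ (hTu i hi) (hTu j hj),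
      inner_tensor_self_eq_sq μ (hTu i hi) (hTv j hj),
      inner_tensor_self_eq_sq μ (hTv i hi) (hTu j hj),
      inner_tensor_self_eq_sq μ (hTv i hi) (hTv j hj)]
  have h_diff : ∀ i < L, ‖Tu i - Tv i‖ ≤ Real.sqrt 2 * ‖u i - v i‖ := by
    intro i hi
    refine le_of_pow_le_pow_left₀ two_ne_zero (by positivity) ?_
    rw [mul_pow, Real.sq_sqrt (by norm_num), ← real_inner_self_eq_norm_sq, h_inner i hi i hi,
      norm_sub_sq_real, real_inner_self_eq_norm_sq, real_inner_self_eq_norm_sq,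
      real_inner_comm (u i) (v i), hu1 i hi, hv1 i hi]
    nlinarith [sq_nonneg (inner ℝ (u i) (v i) - 1)]
  have h_eigenvalues : ‖∑ ℓ ∈ Finset.range L, (a ℓ - b ℓ) • Tv ℓ‖ ≤ E * Real.sqrt L := by
    refine le_of_pow_le_pow_left₀ two_ne_zero (by positivity) ?_
    have hTv1 : ∀ i < L, ‖Tv i‖ ^ 2 = 1 := fun i hi => by
      rw [← real_inner_self_eq_norm_sq, inner_tensor_self_eq_sq μ (hTv i hi) (hTv i hi),
        real_inner_self_eq_norm_sq, hv1 i hi]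
      norm_num
    have h_eq : ‖∑ ℓ ∈ Finset.range L, (a ℓ - b ℓ) • Tv ℓ‖ ^ 2 =
        ∑ ℓ ∈ Finset.range L, (a ℓ - b ℓ) ^ 2 := by
      rw [← real_inner_self_eq_norm_sq, sum_inner]
      refine Finset.sum_congr rfl fun i hi => ?_
      rw [inner_sum, Finset.sum_eq_single_of_mem i hi]
      · rw [real_inner_smul_left, real_inner_smul_right, real_inner_self_eq_norm_sq,
          hTv1 i (Finset.mem_range.1 hi)]
        ring
      · intro j hj hji
        rw [Finset.mem_range] at hi hj
        rw [real_inner_smul_left, real_inner_smul_right,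
          inner_tensor_self_eq_sq μ (hTv i hi) (hTv j hj), hvv i hi j hj hji.symm]
        ring
    rw [h_eq, mul_pow, Real.sq_sqrt (Nat.cast_nonneg L)]
    calc ∑ ℓ ∈ Finset.range L, (a ℓ - b ℓ) ^ 2 ≤ ∑ ℓ ∈ Finset.range L, E ^ 2 :=
          Finset.sum_le_sum fun i hi => sq_le_sq' (abs_le.1 (hab i (Finset.mem_range.1 hi))).1
            (abs_le.1 (hab i (Finset.mem_range.1 hi))).2
      _ = E ^ 2 * L := by simp [mul_comm]
  have h_eigenvectors : ‖∑ ℓ ∈ Finset.range L, a ℓ • (Tu ℓ - Tv ℓ)‖ ≤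
      E * (4 * Real.sqrt 2 * C *
        Real.sqrt (∑ ℓ ∈ Finset.range L, ((δ ℓ)⁻¹ * lam ℓ) ^ 2)) := by
    refine le_of_pow_le_pow_left₀ two_ne_zero (by positivity) ?_
    refine (norm_sq_sum_smul_le_of_inner_nonpos _ a _
      (fun i hi => ha_nonneg i (Finset.mem_range.1 hi)) ?_).trans ?_
    · intro i hi j hj hij
      rw [Finset.mem_range] at hi hj
      rw [h_inner i hi j hj, huu i hi j hj hij, hvv i hi j hj hij]
      nlinarith [sq_nonneg (inner ℝ (u i) (v j)), sq_nonneg (inner ℝ (v i) (u j))]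
    · rw [← mul_assoc, mul_pow, Real.sq_sqrt (Finset.sum_nonneg fun _ _ => sq_nonneg _),
        Finset.mul_sum]
      refine Finset.sum_le_sum fun i hi => ?_
      rw [Finset.mem_range] at hi
      rw [← mul_pow]
      refine pow_le_pow_left₀ (mul_nonneg (ha_nonneg i hi) (norm_nonneg _)) ?_ 2
      calc a i * ‖Tu i - Tv i‖ ≤ lam i * (Real.sqrt 2 * (4 * C * (δ i)⁻¹ * E)) :=
            mul_le_mul (ha_le i hi)
              ((h_diff i hi).trans (mul_le_mul_of_nonneg_left (huv i hi) (Real.sqrt_nonneg _)))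
              (norm_nonneg _) ((ha_nonneg i hi).trans (ha_le i hi))
        _ = E * (4 * Real.sqrt 2 * C) * ((δ i)⁻¹ * lam i) := by ring
  have h_split : ∑ ℓ ∈ Finset.range L, a ℓ • Tu ℓ - ∑ ℓ ∈ Finset.range L, b ℓ • Tv ℓ =
      ∑ ℓ ∈ Finset.range L, (a ℓ - b ℓ) • Tv ℓ +
        ∑ ℓ ∈ Finset.range L, a ℓ • (Tu ℓ - Tv ℓ) := by
    rw [← Finset.sum_sub_distrib, ← Finset.sum_add_distrib]
    refine Finset.sum_congr rfl fun i _ => ?_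
    rw [sub_smul, smul_sub]
    abel
  rw [h_split, ← Real.sqrt_eq_rpow]
  have h_extra : 0 ≤ E * (Real.sqrt 2 * C * Real.sqrt L) := by positivity
  linarith [norm_add_le (∑ ℓ ∈ Finset.range L, (a ℓ - b ℓ) • Tv ℓ)
    (∑ ℓ ∈ Finset.range L, a ℓ • (Tu ℓ - Tv ℓ))]
end
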